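/- Let $k$ be an algebraically closed field of characteristic zero, $K$ a field extension of $k$, $m,n,p \geq 1$, and let $\{u_1,\dots,u_m, v_1,\dots,v_n, w_1,\dots,w_p\} \subseteq K$ be algebraically independent over $k$. Define $t_{i,j,k} := (u_i+v_j)/(v_j+w_k)$ for $1 \leq i \leq m$, $1 \leq j \leq n$, $1 \leq k \leq p$. Then the intermediate field $k(t_{i,j,k} \mid 1 \leq i \leq m, 1 \leq j \leq n, 1 \leq k \leq p)$ has transcendence degree exactly $m+n+p-2$ over $k$. -/

import Mathlib

open IntermediateField in
/-- A family in a field is a transcendence basis of the intermediate field it generates as soon as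
that field has transcendence degree at least the cardinality of the family. -/
theorem isTranscendenceBasis_adjoin_range {k K ι ι' : Type*} [Field k] [Field K] [Algebra k K]
    [Finite ι] [Finite ι'] {x : ι → K} {y : ι' → K} (hx : AlgebraicIndependent k x)
    (hcard : Nat.card ι' ≤ Nat.card ι) (hxy : ∀ i, x i ∈ adjoin k (Set.range y)) :
    IsTranscendenceBasis k
      (fun i ↦ ⟨y i, subset_adjoin k _ ⟨i, rfl⟩⟩ : ι' → adjoin k (Set.range y)) := by
  set E := adjoin k (Set.range y)
  set y' : ι' → E := fun i ↦ ⟨y i, subset_adjoin k _ ⟨i, rfl⟩⟩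
  have hx' : AlgebraicIndependent k (fun i ↦ ⟨x i, hxy i⟩ : ι → E) := .of_comp E.val hx
  have htop : adjoin k (Set.range y') = ⊤ := by
    apply map_injective E.val
    rw [adjoin_map, ← Set.range_comp, ← AlgHom.fieldRange_eq_map, fieldRange_val]
    rfl
  have halg : Algebra.IsAlgebraic (Algebra.adjoin k (Set.range y')) E := by
    rw [← isAlgebraic_adjoin_iff_top, htop]
    exact ⟨fun z ↦ isAlgebraic_algebraMap (⟨z, mem_top⟩ : (⊤ : IntermediateField k E))⟩
  apply Algebra.IsAlgebraic.isTranscendenceBasis_of_lift_le_trdeg_of_finite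
  have h := hx'.lift_cardinalMk_le_trdeg
  rw [← Nat.cast_card, Cardinal.lift_natCast, Cardinal.nat_le_lift_iff] at h ⊢
  exact (Nat.cast_le.mpr hcard).trans h

open IntermediateField in
/-- A finite family is algebraically independent if the field it generates contains an
algebraically independent family of at least the same cardinality. -/
theorem AlgebraicIndependent.of_mem_adjoin_range {k K ι ι' : Type*} [Field k] [Field K]
    [Algebra k K] [Finite ι] [Finite ι'] {x : ι → K} {y : ι' → K} (hx : AlgebraicIndependent k x)
    (hcard : Nat.card ι' ≤ Nat.card ι) (hxy : ∀ i, x i ∈ adjoin k (Set.range y)) :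
    AlgebraicIndependent k y :=
  (isTranscendenceBasis_adjoin_range hx hcard hxy).1.map' (f := (adjoin k (Set.range y)).val)
    Subtype.val_injective

theorem AlgebraicIndependent.add_ne_zero {R A ι : Type*} [CommRing R] [Nontrivial R] [CommRing A]
    [Algebra R A] {x : ι → A} (hx : AlgebraicIndependent R x) {i j : ι} (hij : i ≠ j) :
    x i + x j ≠ 0 := by
  classical
  intro h
  have h0 : (MvPolynomial.X i + MvPolynomial.X j : MvPolynomial ι R) = 0 :=
    hx.eq_zero_of_aeval_eq_zero _ (by simpa using h)
  simpa [hij.symm] using congrArg (MvPolynomial.eval (Pi.single i 1)) h0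

/-- The affine coordinates `(uᵢ + v₀) / (v₀ + w₀)`, `(vⱼ - v₀) / (v₀ + w₀)` and
`(wₗ - w₀) / (v₀ + w₀)`, with `j` and `l` nonzero. -/
def twistedCoord {K : Type*} [Field K] {m n p : ℕ} (u : Fin m → K) (v : Fin (n + 1) → K)
    (w : Fin (p + 1) → K) : Fin m ⊕ Fin n ⊕ Fin p → K :=
  Sum.elim (fun i ↦ (u i + v 0) / (v 0 + w 0))
    (Sum.elim (fun j ↦ (v j.succ - v 0) / (v 0 + w 0)) fun l ↦ (w l.succ - w 0) / (v 0 + w 0))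

theorem algebraicIndependent_twistedCoord {k K : Type*} [Field k] [Field K] [Algebra k K]
    {m n p : ℕ} {u : Fin m → K} {v : Fin (n + 1) → K} {w : Fin (p + 1) → K}
    (hind : AlgebraicIndependent k (Sum.elim u (Sum.elim v w))) :
    AlgebraicIndependent k (twistedCoord u v w) := by
  have hd : v 0 + w 0 ≠ 0 := hind.add_ne_zero (i := .inr (.inl 0)) (j := .inr (.inr 0)) (by simp)
  let y : (Fin m ⊕ Fin n ⊕ Fin p) ⊕ Fin 2 → K := Sum.elim (twistedCoord u v w) ![v 0, w 0]
  suffices hy : AlgebraicIndependent k y from hy.comp Sum.inl Sum.inl_injective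
  refine hind.of_mem_adjoin_range (by simp; omega) ?_
  set E := IntermediateField.adjoin k (Set.range y)
  have hy (a) : y a ∈ E := IntermediateField.subset_adjoin k _ ⟨a, rfl⟩
  have hv : v 0 ∈ E := hy (.inr 0)
  have hw : w 0 ∈ E := hy (.inr 1)
  have hvw := add_mem hv hw
  rintro (i | j | l)
  · have h := sub_mem (mul_mem (hy (.inl (.inl i))) hvw) hv
    simpa [y, twistedCoord, hd] using h
  · refine Fin.cases hv (fun j ↦ ?_) j
    have h := add_mem (mul_mem (hy (.inl (.inr (.inl j)))) hvw) hv
    simpa [y, twistedCoord, hd] using h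
  · refine Fin.cases hw (fun l ↦ ?_) l
    have h := add_mem (mul_mem (hy (.inl (.inr (.inr l)))) hvw) hw
    simpa [y, twistedCoord, hd] using h

theorem adjoin_twisted_eq_adjoin_twistedCoord {k K : Type*} [Field k] [Field K] [Algebra k K]
    {m n p : ℕ} (hm : 1 ≤ m) {u : Fin m → K} {v : Fin (n + 1) → K} {w : Fin (p + 1) → K}
    (hind : AlgebraicIndependent k (Sum.elim u (Sum.elim v w))) :
    IntermediateField.adjoin k {x : K | ∃ (i : Fin m) (j : Fin (n + 1)) (l : Fin (p + 1)),
      x = (u i + v j) / (v j + w l)} =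
    IntermediateField.adjoin k (Set.range (twistedCoord u v w)) := by
  have hvw (j l) : v j + w l ≠ 0 :=
    hind.add_ne_zero (i := .inr (.inl j)) (j := .inr (.inr l)) (by simp)
  have huv (i j) : u i + v j ≠ 0 :=
    hind.add_ne_zero (i := .inl i) (j := .inr (.inl j)) (by simp)
  have huw (i l) : u i - w l ≠ 0 := fun h ↦ by
    simpa using hind.injective (a₁ := .inl i) (a₂ := .inr (.inr l)) (sub_eq_zero.mp h)
  apply le_antisymm <;> rw [IntermediateField.adjoin_le_iff]
  · set E := IntermediateField.adjoin k (Set.range (twistedCoord u v w))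
    have hE (a) : twistedCoord u v w a ∈ E := IntermediateField.subset_adjoin k _ ⟨a, rfl⟩
    have ha (i) : (u i + v 0) / (v 0 + w 0) ∈ E := hE (.inl i)
    have hb (j) : (v j - v 0) / (v 0 + w 0) ∈ E :=
      Fin.cases (by simp) (fun j ↦ hE (.inr (.inl j))) j
    have hc (l) : (w l - w 0) / (v 0 + w 0) ∈ E :=
      Fin.cases (by simp) (fun l ↦ hE (.inr (.inr l))) l
    rintro _ ⟨i, j, l, rfl⟩
    have h := div_mem (add_mem (ha i) (hb j)) (add_mem (add_mem (one_mem E) (hb j)) (hc l))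
    rw [SetLike.mem_coe]
    convert h using 1
    have h0 := hvw 0 0
    have h1 := hvw j l
    have h2 : 1 + (v j - v 0) / (v 0 + w 0) + (w l - w 0) / (v 0 + w 0)
        = (v j + w l) / (v 0 + w 0) := by field_simp; ring
    rw [h2]
    field_simp
    ring
  · set L := IntermediateField.adjoin k
      {x : K | ∃ (i : Fin m) (j : Fin (n + 1)) (l : Fin (p + 1)), x = (u i + v j) / (v j + w l)}
    have ht (i j l) : (u i + v j) / (v j + w l) ∈ L :=
      IntermediateField.subset_adjoin k _ ⟨i, j, l, rfl⟩
    let i₀ : Fin m := ⟨0, hm⟩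
    have h0 := hvw 0 0
    have h1 := huv i₀ 0
    rintro _ ⟨i | j | l, rfl⟩
    · exact ht i 0 0
    · have h := div_mem (sub_mem (ht i₀ 0 0) (ht i₀ j.succ 0))
        (sub_mem (ht i₀ j.succ 0) (one_mem L))
      rw [SetLike.mem_coe]
      convert h using 1
      have h2 := hvw j.succ 0
      have h3 := huw i₀ 0
      have h4 : (u i₀ + v j.succ) / (v j.succ + w 0) - 1 = (u i₀ - w 0) / (v j.succ + w 0) := by
        field_simp; ring
      rw [h4]
      simp only [twistedCoord, Sum.elim_inr, Sum.elim_inl]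
      field_simp
      ring
    · have h := sub_mem (div_mem (ht i₀ 0 0) (ht i₀ 0 l.succ)) (one_mem L)
      rw [SetLike.mem_coe]
      convert h using 1
      have h2 := hvw 0 l.succ
      simp only [twistedCoord, Sum.elim_inr]
      field_simp
      ring


/-- If `u₁,…,u_m, v₁,…,v_n, w₁,…,w_p ∈ K` (with `m,n,p ≥ 1`) are
algebraically independent over an algebraically closed field `k` of characteristic
zero, then the intermediate field generated over `k` by all the elements
`t i j l = (uᵢ+vⱼ)/(vⱼ+wₗ)` has transcendence degree exactly `m+n+p-2` over `k`
(i.e. it admits a transcendence basis indexed by `Fin (m+n+p-2)`). -/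
theorem twisted_array_trdeg {k K : Type*} [Field k] [IsAlgClosed k] [CharZero k]
    [Field K] [Algebra k K] (m n p : ℕ) (hm : 1 ≤ m) (hn : 1 ≤ n) (hp : 1 ≤ p)
    (u : Fin m → K) (v : Fin n → K) (w : Fin p → K)
    (hind : AlgebraicIndependent k (Sum.elim u (Sum.elim v w))) :
    ∃ b : Fin (m + n + p - 2) → (IntermediateField.adjoin k
        {x : K | ∃ (i : Fin m) (j : Fin n) (l : Fin p),
          x = (u i + v j) / (v j + w l)} : IntermediateField k K),
      IsTranscendenceBasis k b := by
  obtain ⟨n, rfl⟩ := Nat.exists_eq_add_of_le' hn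
  obtain ⟨p, rfl⟩ := Nat.exists_eq_add_of_le' hp
  rw [adjoin_twisted_eq_adjoin_twistedCoord hm hind]
  have hb := isTranscendenceBasis_adjoin_range (algebraicIndependent_twistedCoord hind) le_rfl
    fun a ↦ IntermediateField.subset_adjoin k _ ⟨a, rfl⟩
  have e : Fin (m + (n + 1) + (p + 1) - 2) ≃ Fin m ⊕ Fin n ⊕ Fin p :=
    Fintype.equivOfCardEq (by simp; omega)
  exact ⟨_, hb.comp_equiv e⟩
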